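/- Let f : ℝⁿ → ℝ and g : ℝⁿ → ℝᵐ be continuously differentiable, K ⊆ ℝᵐ closed, C = g⁻¹(K), x̄ ∈ C, d ∈ T_C(x̄), and suppose x̄ is a local optimal solution of min f subject to g(x) ∈ K in direction d with ∇f(x̄)·d = 0. Assume M(x) = g(x) − K is metrically subregular at (x̄,0) in direction d with modulus κ. Then there exists λ ∈ N_K(g(x̄); ∇g(x̄)d) with ‖λ‖ ≤ κ‖∇f(x̄)‖ and ∇f(x̄) + ∇g(x̄)ᵀλ = 0. -/

import Mathlib

open Filter Topology Set
open scoped RealInnerProductSpace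

noncomputable section

variable {E : Type*} [NormedAddCommGroup E] [InnerProductSpace ℝ E]

/-- Bouligand (contingent) tangent cone. -/
def tangentConeB (S : Set E) (x : E) : Set E :=
  {d | ∃ (t : ℕ → ℝ) (dk : ℕ → E), (∀ k, 0 < t k) ∧
    Tendsto t atTop (nhds 0) ∧ Tendsto dk atTop (nhds d) ∧
    ∀ k, x + t k • dk k ∈ S}

/-- Outer second-order tangent set. -/
def secondTangent (S : Set E) (x d : E) : Set E :=
  {w | ∃ (t : ℕ → ℝ) (wk : ℕ → E), (∀ k, 0 < t k) ∧
    Tendsto t atTop (nhds 0) ∧ Tendsto wk atTop (nhds w) ∧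
    ∀ k, x + t k • d + ((1/2 : ℝ) * t k ^ 2) • wk k ∈ S}

/-- Asymptotic second-order tangent cone. -/
def asympTangent (S : Set E) (x d : E) : Set E :=
  {w | ∃ (t r : ℕ → ℝ) (wk : ℕ → E), (∀ k, 0 < t k) ∧ (∀ k, 0 < r k) ∧
    Tendsto t atTop (nhds 0) ∧ Tendsto r atTop (nhds 0) ∧
    Tendsto (fun k => t k / r k) atTop (nhds 0) ∧
    Tendsto wk atTop (nhds w) ∧
    ∀ k, x + t k • d + ((1/2 : ℝ) * t k * r k) • wk k ∈ S}

/-- Fréchet (regular) normal cone (empty, by convention, outside of `S`). -/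
def frechetNormal (S : Set E) (x : E) : Set E :=
  {v | x ∈ S ∧ ∀ ε > (0:ℝ), ∃ δ > (0:ℝ), ∀ y ∈ S, ‖y - x‖ < δ →
    ⟪v, y - x⟫ ≤ ε * ‖y - x‖}

/-- Limiting (Mordukhovich) normal cone. -/
def limitingNormal (S : Set E) (x : E) : Set E :=
  {v | ∃ (xk vk : ℕ → E), Tendsto xk atTop (nhds x) ∧
    Tendsto vk atTop (nhds v) ∧ ∀ k, vk k ∈ frechetNormal S (xk k)}

/-- Directional limiting normal cone. -/
def dirLimitingNormal (S : Set E) (x d : E) : Set E :=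
  {v | ∃ (t : ℕ → ℝ) (dk vk : ℕ → E), (∀ k, 0 < t k) ∧
    Tendsto t atTop (nhds 0) ∧ Tendsto dk atTop (nhds d) ∧
    Tendsto vk atTop (nhds v) ∧ ∀ k, vk k ∈ frechetNormal S (x + t k • dk k)}

/-- Directional regular (Clarke) tangent cone. -/
def dirClarkeTangent (S : Set E) (x d : E) : Set E :=
  {v | ∀ (t : ℕ → ℝ) (dk : ℕ → E), (∀ k, 0 < t k) →
    Tendsto t atTop (nhds 0) → Tendsto dk atTop (nhds d) →
    (∀ k, x + t k • dk k ∈ S) →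
    ∃ vk : ℕ → E, Tendsto vk atTop (nhds v) ∧
      ∀ k, vk k ∈ tangentConeB S (x + t k • dk k)}

/-- Directional neighborhood `V_{ρ,δ}(d)`. -/
def dirNbhd (d : E) (ρ δ : ℝ) : Set E :=
  {w | ‖w‖ ≤ δ ∧ ‖‖d‖ • w - ‖w‖ • d‖ ≤ ρ * ‖w‖ * ‖d‖}

/-- Support function, with values in `EReal` (so that `σ_∅ = -∞`). -/
def suppFn (A : Set E) (l : E) : EReal :=
  ⨆ u ∈ A, ((⟪l, u⟫ : ℝ) : EReal)

variable {F : Type*} [NormedAddCommGroup F] [InnerProductSpace ℝ F]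

theorem exists_smul_mem_dirNbhd (d : E) {ρ δ : ℝ} (hρ : 0 < ρ) (hδ : 0 < δ) :
    ∃ σ > (0 : ℝ), ∀ t > (0 : ℝ), t ≤ σ → ∀ v : E, ‖v - d‖ ≤ σ → t • v ∈ dirNbhd d ρ δ := by
  rcases eq_or_ne d 0 with rfl | hd
  · refine ⟨min 1 δ, by positivity, fun t ht htσ v hv => ⟨?_, by simp⟩⟩
    rw [norm_smul, Real.norm_of_nonneg ht.le]
    have h1 : ‖v‖ ≤ 1 := by simpa using hv.trans (min_le_left _ _)
    have h2 := htσ.trans (min_le_right 1 δ)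
    nlinarith [norm_nonneg v]
  · have hd' : 0 < ‖d‖ := norm_pos_iff.2 hd
    refine ⟨min (min (‖d‖ / 2) (ρ * ‖d‖ / 4)) (δ / (2 * ‖d‖)), by positivity,
      fun t ht htσ v hv => ?_⟩
    have h1 : ‖v - d‖ ≤ ‖d‖ / 2 := hv.trans ((min_le_left _ _).trans (min_le_left _ _))
    have h2 : ‖v - d‖ ≤ ρ * ‖d‖ / 4 := hv.trans ((min_le_left _ _).trans (min_le_right _ _))
    have h3 : t * (2 * ‖d‖) ≤ δ := (le_div_iff₀ (by positivity)).1 (htσ.trans (min_le_right _ _))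
    have h4 : ‖v‖ ≤ 2 * ‖d‖ := by
      have := norm_sub_norm_le v d
      linarith
    have h5 : ‖d‖ / 2 ≤ ‖v‖ := by
      have := norm_sub_norm_le d v
      rw [norm_sub_rev] at this
      linarith
    constructor
    · rw [norm_smul, Real.norm_of_nonneg ht.le]
      nlinarith
    · have e : ‖d‖ • t • v - ‖t • v‖ • d = t • (‖d‖ • (v - d) + (‖d‖ - ‖v‖) • d) := by
        rw [norm_smul, Real.norm_of_nonneg ht.le]
        module
      have h6 : ‖‖d‖ • (v - d) + (‖d‖ - ‖v‖) • d‖ ≤ 2 * ‖v - d‖ * ‖d‖ := by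
        refine (norm_add_le _ _).trans ?_
        rw [norm_smul, norm_smul, norm_norm, Real.norm_eq_abs]
        have := abs_norm_sub_norm_le d v
        rw [norm_sub_rev] at this
        nlinarith
      rw [e, norm_smul, norm_smul, Real.norm_of_nonneg ht.le]
      have h7 : 2 * ‖v - d‖ * ‖d‖ ≤ ρ * ‖v‖ * ‖d‖ := by
        have : 2 * ‖v - d‖ ≤ ρ * ‖v‖ := by nlinarith
        gcongr
      nlinarith

/-- The first-order condition for a local minimum over a set, in terms of Fréchet normals. -/
theorem IsLocalMinOn.neg_mem_frechetNormal {φ : F → ℝ} {S : Set F} {y v : F}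
    (hmin : IsLocalMinOn φ S y) (hy : y ∈ S) (hφ : HasFDerivAt φ (innerSL ℝ v) y) :
    -v ∈ frechetNormal S y := by
  refine ⟨hy, fun ε hε => ?_⟩
  have h1 := hφ.isLittleO.def hε
  have h2 := eventually_nhdsWithin_iff.1 hmin
  obtain ⟨δ, hδ, h⟩ := Metric.eventually_nhds_iff.1 (h1.and h2)
  refine ⟨δ, hδ, fun z hz hzy => ?_⟩
  obtain ⟨h3, h4⟩ := h (by rwa [dist_eq_norm])
  have h5 := h4 hz
  have h6 := (abs_le.1 h3).2
  simp only [innerSL_apply_apply] at h6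
  rw [inner_neg_left]
  linarith

theorem hasFDerivAt_sqrt_norm_sq_add {h : E → F} {h' : E →L[ℝ] F} {x : E}
    (hh : HasFDerivAt h h' x) {s : ℝ} (hs : 0 < s) :
    HasFDerivAt (fun x => √(‖h x‖ ^ 2 + s ^ 2))
      ((innerSL ℝ ((√(‖h x‖ ^ 2 + s ^ 2))⁻¹ • h x)).comp h') x := by
  have h1 := (hh.norm_sq.add_const (s ^ 2)).sqrt (by positivity)
  refine h1.congr_fderiv ?_
  ext u
  have : √(‖h x‖ ^ 2 + s ^ 2) ≠ 0 := by positivity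
  simp
  field_simp

/-- A smoothed penalty argument: near an approximate minimizer of the penalized function
`f + μ * infDist (g ·) K` there is an approximate multiplier. -/
theorem exists_approx_multiplier [ProperSpace E] [ProperSpace F] {f : E → ℝ} {g : E → F}
    (hf : Differentiable ℝ f) (hg : Differentiable ℝ g) {K : Set F} (hK : IsClosed K)
    {x₀ : E} (hx₀ : g x₀ ∈ K) {r μ s a e c : ℝ} (hr : 0 < r) (hμ : 0 ≤ μ) (hs : 0 < s)
    (ha : 0 < a) (hlow : ∀ x, ‖x - x₀‖ ≤ r → c ≤ f x + μ * Metric.infDist (g x) K)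
    (hup : f x₀ + μ * s ≤ c + e) (her : e < a * r ^ 2) :
    ∃ x y w, a * ‖x - x₀‖ ^ 2 ≤ e ∧ a * ‖y - g x₀‖ ^ 2 ≤ e ∧ ‖w‖ ≤ μ ∧
      w - (2 * a) • (y - g x₀) ∈ frechetNormal K y ∧
      ∀ u, fderiv ℝ f x u + ⟪w, fderiv ℝ g x u⟫ + 2 * a * ⟪x - x₀, u⟫ = 0 := by
  let Φ : E × F → ℝ := fun p => f p.1 + μ * √(‖g p.1 - p.2‖ ^ 2 + s ^ 2) +
    a * ‖p.1 - x₀‖ ^ 2 + a * ‖p.2 - g x₀‖ ^ 2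
  have hΦ : Continuous Φ := by
    have := hf.continuous
    have := hg.continuous
    fun_prop
  have hcomp : IsCompact (Metric.closedBall x₀ r ×ˢ (K ∩ Metric.closedBall (g x₀) r)) :=
    (isCompact_closedBall _ _).prod ((isCompact_closedBall _ _).inter_left hK)
  have hmem : (x₀, g x₀) ∈ Metric.closedBall x₀ r ×ˢ (K ∩ Metric.closedBall (g x₀) r) :=
    ⟨Metric.mem_closedBall_self hr.le, hx₀, Metric.mem_closedBall_self hr.le⟩
  obtain ⟨⟨x, y⟩, ⟨hxr, hyK, hyr⟩, hmin⟩ := hcomp.exists_isMinOn ⟨_, hmem⟩ hΦ.continuousOn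
  simp only [mem_closedBall_iff_norm] at hxr hyr
  have hval : Φ (x, y) ≤ c + e := by
    refine (hmin hmem).trans ?_
    simpa [Φ, Real.sqrt_sq hs.le] using hup
  have hsqrt : Metric.infDist (g x) K ≤ √(‖g x - y‖ ^ 2 + s ^ 2) := by
    refine (Metric.infDist_le_dist_of_mem hyK).trans ?_
    rw [dist_eq_norm]
    exact Real.le_sqrt_of_sq_le (by nlinarith)
  have hbound : a * ‖x - x₀‖ ^ 2 + a * ‖y - g x₀‖ ^ 2 ≤ e := by
    have h1 := hlow x hxr
    have h2 := mul_le_mul_of_nonneg_left hsqrt hμ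
    simp only [Φ] at hval
    linarith
  have hxe : a * ‖x - x₀‖ ^ 2 ≤ e := by linarith [show 0 ≤ a * ‖y - g x₀‖ ^ 2 by positivity]
  have hye : a * ‖y - g x₀‖ ^ 2 ≤ e := by linarith [show 0 ≤ a * ‖x - x₀‖ ^ 2 by positivity]
  have hxlt : ‖x - x₀‖ < r :=
    lt_of_pow_lt_pow_left₀ 2 hr.le (lt_of_mul_lt_mul_left (hxe.trans_lt her) ha.le)
  have hylt : ‖y - g x₀‖ < r :=
    lt_of_pow_lt_pow_left₀ 2 hr.le (lt_of_mul_lt_mul_left (hye.trans_lt her) ha.le)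
  have hq : 0 < √(‖g x - y‖ ^ 2 + s ^ 2) := by positivity
  set q := √(‖g x - y‖ ^ 2 + s ^ 2) with hqdef
  refine ⟨x, y, μ • q⁻¹ • (g x - y), hxe, hye, ?_, ?_, ?_⟩
  · rw [norm_smul, norm_smul, Real.norm_of_nonneg hμ, norm_inv, Real.norm_of_nonneg hq.le]
    refine mul_le_of_le_one_right hμ ?_
    rw [inv_mul_le_one₀ hq]
    exact Real.le_sqrt_of_sq_le (by nlinarith)
  · have hloc : IsLocalMinOn (fun z => Φ (x, z)) K y := by
      have : ∀ᶠ z in 𝓝 y, z ∈ Metric.ball (g x₀) r :=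
        Metric.isOpen_ball.mem_nhds (mem_ball_iff_norm.2 hylt)
      filter_upwards [self_mem_nhdsWithin, nhdsWithin_le_nhds this] with z hz hzr
      exact hmin ⟨mem_closedBall_iff_norm.2 hxr, hz, Metric.ball_subset_closedBall hzr⟩
    have h1 := hasFDerivAt_sqrt_norm_sq_add ((hasFDerivAt_id (𝕜 := ℝ) y).const_sub (g x)) hs
    have h2 := ((hasFDerivAt_id (𝕜 := ℝ) y).sub_const (g x₀)).norm_sq
    have h3 := (((h1.const_mul μ).const_add (f x)).add_const (a * ‖x - x₀‖ ^ 2)).add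
      (h2.const_mul a)
    have h4 := hloc.neg_mem_frechetNormal hyK
      (v := -(μ • q⁻¹ • (g x - y) - (2 * a) • (y - g x₀))) (h3.congr_fderiv ?_)
    · rwa [neg_neg] at h4
    · ext u
      simp [← hqdef]
      ring
  · have hloc : IsLocalMin (fun z => Φ (z, y)) x := by
      have : ∀ᶠ z in 𝓝 x, z ∈ Metric.ball x₀ r :=
        Metric.isOpen_ball.mem_nhds (mem_ball_iff_norm.2 hxlt)
      filter_upwards [this] with z hzr
      exact hmin ⟨Metric.ball_subset_closedBall hzr, hyK, mem_closedBall_iff_norm.2 hyr⟩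
    have h1 := hasFDerivAt_sqrt_norm_sq_add ((hg x).hasFDerivAt.sub_const y) hs
    have h2 := ((hasFDerivAt_id (𝕜 := ℝ) x).sub_const x₀).norm_sq
    have h3 := ((((hf x).hasFDerivAt.add (h1.const_mul μ))).add (h2.const_mul a)).add_const
      (a * ‖y - g x₀‖ ^ 2)
    have h4 := hloc.hasFDerivAt_eq_zero h3
    intro u
    have h5 := DFunLike.congr_fun h4 u
    simp [← hqdef] at h5
    simp [inner_sub_left, inner_smul_left]
    linarith

/-- The directional exact penalty principle: on balls of radius proportional to `t` around
`xb + t • v`, the penalized objective is bounded below by its value at `xb`. -/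
theorem exists_penalty_lower_bound [ProperSpace E] {G : Type*} [PseudoMetricSpace G]
    {f : E → ℝ} {g : E → G} {K : Set G} {xb d : E}
    (hC : IsClosed (g ⁻¹' K)) {f' : E →L[ℝ] ℝ} (hf : HasStrictFDerivAt f f' xb)
    (hopt : ∃ ρ > (0:ℝ), ∃ δ > (0:ℝ), ∀ x ∈ g ⁻¹' K, x - xb ∈ dirNbhd d ρ δ → f xb ≤ f x)
    {κ : ℝ}
    (hsub : ∃ ρ > (0:ℝ), ∃ δ > (0:ℝ), ∀ x : E, x - xb ∈ dirNbhd d ρ δ →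
      Metric.infDist x (g ⁻¹' K) ≤ κ * Metric.infDist (g x) K) {L : ℝ} (hL : ‖f'‖ < L) :
    ∃ σ > (0 : ℝ), ∀ t > (0 : ℝ), t ≤ σ → ∀ v : E, ‖v - d‖ ≤ σ → xb + t • v ∈ g ⁻¹' K →
      ∀ x, ‖x - (xb + t • v)‖ ≤ σ * t → f xb ≤ f x + κ * L * Metric.infDist (g x) K := by
  obtain ⟨ρ₁, hρ₁, δ₁, hδ₁, hopt⟩ := hopt
  obtain ⟨ρ₂, hρ₂, δ₂, hδ₂, hsub⟩ := hsub
  obtain ⟨σ₁, hσ₁, h₁⟩ := exists_smul_mem_dirNbhd d hρ₁ hδ₁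
  obtain ⟨σ₂, hσ₂, h₂⟩ := exists_smul_mem_dirNbhd d hρ₂ hδ₂
  have hL0 : 0 ≤ L := (norm_nonneg _).trans hL.le
  obtain ⟨s, hs, hlip⟩ := hf.exists_lipschitzOnWith_of_nnnorm_lt (K := ⟨L, hL0⟩) hL
  obtain ⟨R, hR, hRs⟩ := Metric.mem_nhds_iff.1 hs
  obtain ⟨σ, hσ, hσ1, hσ2, hσR⟩ : ∃ σ > (0 : ℝ), 3 * σ ≤ σ₁ ∧ 3 * σ ≤ σ₂ ∧
      σ * (‖d‖ + 3 * σ) < R := by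
    have hcont : Tendsto (fun σ : ℝ => σ * (‖d‖ + 3 * σ)) (𝓝 0) (𝓝 0) := by
      have : Continuous (fun σ : ℝ => σ * (‖d‖ + 3 * σ)) := by fun_prop
      simpa using this.tendsto 0
    have h1 : ∀ᶠ σ in 𝓝[>] (0 : ℝ), σ * (‖d‖ + 3 * σ) < R :=
      nhdsWithin_le_nhds (hcont.eventually (gt_mem_nhds hR))
    have h2 : ∀ᶠ σ in 𝓝[>] (0 : ℝ), σ < σ₁ / 3 :=
      nhdsWithin_le_nhds (gt_mem_nhds (by positivity))
    have h3 : ∀ᶠ σ in 𝓝[>] (0 : ℝ), σ < σ₂ / 3 :=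
      nhdsWithin_le_nhds (gt_mem_nhds (by positivity))
    obtain ⟨σ, h1, h2, h3, h4⟩ := (h1.and (h2.and (h3.and self_mem_nhdsWithin))).exists
    exact ⟨σ, h4, by linarith, by linarith, h1⟩
  have key : ∀ t > (0 : ℝ), t ≤ σ → ∀ v : E, ‖v - d‖ ≤ σ → ∀ x, ‖x - (xb + t • v)‖ ≤ 2 * σ * t →
      x ∈ s ∧ x - xb ∈ dirNbhd d ρ₁ δ₁ ∧ x - xb ∈ dirNbhd d ρ₂ δ₂ := by
    intro t ht htσ v hv x hx
    have e : x - xb = t • (t⁻¹ • (x - xb)) := by rw [smul_inv_smul₀ ht.ne']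
    have hw : ‖t⁻¹ • (x - xb) - d‖ ≤ 3 * σ := by
      have e2 : t⁻¹ • (x - xb) - d = t⁻¹ • (x - (xb + t • v)) + (v - d) := by
        rw [← sub_sub, smul_sub t⁻¹ (x - xb), inv_smul_smul₀ ht.ne']
        abel
      rw [e2]
      refine (norm_add_le _ _).trans ?_
      rw [norm_smul, norm_inv, Real.norm_of_nonneg ht.le]
      have : t⁻¹ * ‖x - (xb + t • v)‖ ≤ 2 * σ := by
        rw [inv_mul_le_iff₀ ht]
        linarith
      linarith
    refine ⟨hRs ?_, ?_, ?_⟩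
    · rw [mem_ball_iff_norm, e, norm_smul, Real.norm_of_nonneg ht.le]
      have : ‖t⁻¹ • (x - xb)‖ ≤ ‖d‖ + 3 * σ := by
        have := norm_sub_norm_le (t⁻¹ • (x - xb)) d
        linarith
      exact (mul_le_mul htσ this (norm_nonneg _) hσ.le).trans_lt hσR
    · rw [e]
      exact h₁ t ht (by linarith) _ (hw.trans hσ1)
    · rw [e]
      exact h₂ t ht (by linarith) _ (hw.trans hσ2)
  refine ⟨σ, hσ, fun t ht htσ v hv hmem x hx => ?_⟩
  obtain ⟨hxs, -, hx2⟩ := key t ht htσ v hv x (by nlinarith)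
  obtain ⟨y, hyC, hy⟩ := hC.exists_infDist_eq_dist ⟨_, hmem⟩ x
  have hxy : dist x y ≤ σ * t := by
    rw [← hy]
    refine (Metric.infDist_le_dist_of_mem hmem).trans ?_
    rwa [dist_eq_norm]
  obtain ⟨hys, hy1, -⟩ := key t ht htσ v hv y (by
    rw [← dist_eq_norm] at hx ⊢
    rw [dist_comm] at hxy
    linarith [dist_triangle y x (xb + t • v)])
  have h3 := hopt y hyC hy1
  have h4 : dist (f y) (f x) ≤ L * dist y x := hlip.dist_le_mul y hys x hxs
  rw [Real.dist_eq, dist_comm, ← hy] at h4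
  have h5 := mul_le_mul_of_nonneg_left (hsub x hx2) hL0
  have h6 := (abs_le.1 h4).2
  linarith

/-- Approximate directional multipliers with arbitrary tolerance. -/
theorem exists_approx_dir_multiplier [ProperSpace E] [ProperSpace F] {f : E → ℝ} {g : E → F}
    (hf : ContDiff ℝ 1 f) (hg : ContDiff ℝ 1 g) {K : Set F} (hK : IsClosed K) {xb d : E}
    (hd : d ∈ tangentConeB (g ⁻¹' K) xb)
    (hopt : ∃ ρ > (0:ℝ), ∃ δ > (0:ℝ), ∀ x ∈ g ⁻¹' K, x - xb ∈ dirNbhd d ρ δ → f xb ≤ f x)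
    (hcrit : fderiv ℝ f xb d = 0) {κ : ℝ} (hκ : 0 < κ)
    (hsub : ∃ ρ > (0:ℝ), ∃ δ > (0:ℝ), ∀ x : E, x - xb ∈ dirNbhd d ρ δ →
      Metric.infDist x (g ⁻¹' K) ≤ κ * Metric.infDist (g x) K) {ε : ℝ} (hε : 0 < ε) :
    ∃ (t : ℝ) (x : E) (v l : F), 0 < t ∧ t ≤ ε ∧ ‖x - xb‖ ≤ ε ∧
      ‖v - fderiv ℝ g xb d‖ ≤ ε ∧ l ∈ frechetNormal K (g xb + t • v) ∧
      ‖l‖ ≤ κ * (‖fderiv ℝ f xb‖ + ε) + ε ∧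
      ∀ u, |fderiv ℝ f x u + ⟪l, fderiv ℝ g x u⟫| ≤ ε * (‖u‖ + ‖fderiv ℝ g x u‖) := by
  have hfd := hf.differentiable one_ne_zero
  have hgd := hg.differentiable one_ne_zero
  set L := ‖fderiv ℝ f xb‖ + ε with hLdef
  have hL0 : 0 < L := by positivity
  obtain ⟨σ, hσ, hlow⟩ := exists_penalty_lower_bound (hK.preimage hg.continuous)
    (hf.contDiffAt.hasStrictFDerivAt one_ne_zero) hopt hsub (L := L) (by linarith)
  obtain ⟨t, v, ht, ht0, hv, hmem⟩ := hd
  set η := min (σ / 2) (ε / 2)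
  have hη0 : 0 < η := by positivity
  have hησ : η < σ := (min_le_left _ _).trans_lt (by linarith)
  have hηε : 2 * η ≤ ε := by linarith [min_le_right (σ / 2) (ε / 2)]
  have htv0 : Tendsto (fun k => t k • v k) atTop (𝓝 0) := by simpa using ht0.smul hv
  have htv : Tendsto (fun k => (t k)⁻¹ • t k • v k) atTop (𝓝 d) :=
    hv.congr fun k => (inv_smul_smul₀ (ht k).ne' _).symm
  have hflim : Tendsto (fun k => (t k)⁻¹ * (f (xb + t k • v k) - f xb)) atTop (𝓝 0) := by
    rw [← hcrit]
    exact (hfd xb).hasFDerivAt.hasFDerivWithinAt.lim (s := univ) htv0 (by simp) htv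
  have hglim : Tendsto (fun k => (t k)⁻¹ • (g (xb + t k • v k) - g xb)) atTop
      (𝓝 (fderiv ℝ g xb d)) :=
    (hgd xb).hasFDerivAt.hasFDerivWithinAt.lim (s := univ) htv0 (by simp) htv
  have hxlim : Tendsto (fun k => ‖t k • v k‖ + η * t k) atTop (𝓝 0) := by
    simpa using htv0.norm.add (ht0.const_mul η)
  obtain ⟨k, h1, h2, h3, h4, h5, h6⟩ := ((hflim.eventually (gt_mem_nhds
    (show 0 < η ^ 2 / 2 by positivity))).and <| (hglim.eventually (Metric.closedBall_mem_nhds _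
    hη0)).and <| (hxlim.eventually (gt_mem_nhds hε)).and <|
    (ht0.eventually (gt_mem_nhds hσ)).and <| (ht0.eventually (gt_mem_nhds hε)).and <|
    (hv.eventually (Metric.closedBall_mem_nhds _ hσ))).exists
  replace h2 := mem_closedBall_iff_norm.1 h2
  replace h6 := mem_closedBall_iff_norm.1 h6
  have htk := ht k
  have hm := hmem k
  generalize t k = τ at h1 h2 h3 h4 h5 htk hm
  generalize v k = z at h1 h2 h3 h6 hm
  have hs : κ * L * (η ^ 2 * τ / (2 * (κ * L))) = η ^ 2 * τ / 2 := by
    field_simp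
  obtain ⟨x, y, w, hx, hy, hw, hwN, hu⟩ := exists_approx_multiplier hfd hgd hK hm
    (r := σ * τ) (μ := κ * L) (s := η ^ 2 * τ / (2 * (κ * L))) (a := τ⁻¹) (e := η ^ 2 * τ)
    (c := f xb) (by positivity) (by positivity) (by positivity) (by positivity)
    (hlow τ htk h4.le z h6 hm)
    (by
      rw [inv_mul_lt_iff₀ htk] at h1
      rw [hs]
      linarith)
    (by
      rw [show τ⁻¹ * (σ * τ) ^ 2 = σ ^ 2 * τ by field_simp]
      gcongr)
  have hsq : ∀ b : ℝ, τ⁻¹ * b ^ 2 ≤ η ^ 2 * τ → b ≤ η * τ := by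
    intro b hb
    rw [inv_mul_le_iff₀ htk] at hb
    exact le_of_sq_le_sq (by linarith) (by positivity)
  have hx' := hsq _ hx
  have hy' := hsq _ hy
  have hy2 : ‖(2 * τ⁻¹) • (y - g (xb + τ • z))‖ ≤ ε := by
    rw [norm_smul, Real.norm_of_nonneg (by positivity), mul_assoc]
    have := (inv_mul_le_iff₀ htk).2 (hy'.trans_eq (mul_comm _ _))
    linarith
  refine ⟨τ, x, τ⁻¹ • (y - g xb), w - (2 * τ⁻¹) • (y - g (xb + τ • z)), htk, h5.le,
    ?_, ?_, ?_, ?_, ?_⟩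
  · have : x - xb = (x - (xb + τ • z)) + τ • z := by abel
    rw [this]
    exact (norm_add_le _ _).trans (by linarith)
  · have : τ⁻¹ • (y - g xb) - fderiv ℝ g xb d = τ⁻¹ • (y - g (xb + τ • z)) +
        (τ⁻¹ • (g (xb + τ • z) - g xb) - fderiv ℝ g xb d) := by module
    rw [this]
    refine (norm_add_le _ _).trans ?_
    rw [norm_smul, norm_inv, Real.norm_of_nonneg htk.le]
    have := (inv_mul_le_iff₀ htk).2 (hy'.trans_eq (mul_comm _ _))
    linarith
  · rwa [smul_inv_smul₀ htk.ne', add_sub_cancel]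
  · exact (norm_sub_le _ _).trans (by linarith)
  · intro u
    have h7 : fderiv ℝ f x u + ⟪w - (2 * τ⁻¹) • (y - g (xb + τ • z)), fderiv ℝ g x u⟫ =
        -⟪(2 * τ⁻¹) • (x - (xb + τ • z)), u⟫ -
          ⟪(2 * τ⁻¹) • (y - g (xb + τ • z)), fderiv ℝ g x u⟫ := by
      rw [inner_sub_left, inner_smul_left (x - _)]
      simp only [conj_trivial]
      linarith [hu u]
    have hx2 : ‖(2 * τ⁻¹) • (x - (xb + τ • z))‖ ≤ ε := by
      rw [norm_smul, Real.norm_of_nonneg (by positivity), mul_assoc]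
      have := (inv_mul_le_iff₀ htk).2 (hx'.trans_eq (mul_comm _ _))
      linarith
    have h8 := (abs_real_inner_le_norm ((2 * τ⁻¹) • (x - (xb + τ • z))) u).trans
      (mul_le_mul_of_nonneg_right hx2 (norm_nonneg _))
    have h9 := (abs_real_inner_le_norm ((2 * τ⁻¹) • (y - g (xb + τ • z)))
      (fderiv ℝ g x u)).trans (mul_le_mul_of_nonneg_right hy2 (norm_nonneg _))
    rw [h7, abs_le]
    rw [abs_le] at h8 h9
    constructor <;> linarith [h8.1, h8.2, h9.1, h9.2]

theorem stmt16 {n m : ℕ} (f : EuclideanSpace ℝ (Fin n) → ℝ) (hf : ContDiff ℝ 1 f)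
    (g : EuclideanSpace ℝ (Fin n) → EuclideanSpace ℝ (Fin m)) (hg : ContDiff ℝ 1 g)
    (K : Set (EuclideanSpace ℝ (Fin m))) (hK : IsClosed K)
    (xb : EuclideanSpace ℝ (Fin n)) (hxb : xb ∈ g ⁻¹' K)
    (d : EuclideanSpace ℝ (Fin n)) (hd : d ∈ tangentConeB (g ⁻¹' K) xb)
    (hopt : ∃ ρ > (0:ℝ), ∃ δ > (0:ℝ), ∀ x ∈ g ⁻¹' K, x - xb ∈ dirNbhd d ρ δ → f xb ≤ f x)
    (hcrit : fderiv ℝ f xb d = 0)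
    (κ : ℝ) (hκ : 0 < κ)
    (hsub : ∃ ρ > (0:ℝ), ∃ δ > (0:ℝ), ∀ x : EuclideanSpace ℝ (Fin n),
      x - xb ∈ dirNbhd d ρ δ →
      Metric.infDist x (g ⁻¹' K) ≤ κ * Metric.infDist (g x) K) :
    ∃ l ∈ dirLimitingNormal K (g xb) (fderiv ℝ g xb d),
      ‖l‖ ≤ κ * ‖fderiv ℝ f xb‖ ∧
      ∀ u, fderiv ℝ f xb u + ⟪l, fderiv ℝ g xb u⟫ = 0 := by
  have happrox := fun k : ℕ => exists_approx_dir_multiplier hf hg hK hd hopt hcrit hκ hsub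
    (Nat.one_div_pos_of_nat (α := ℝ) (n := k))
  choose t x v l ht htk hx hv hl hln hu using happrox
  have hε : Tendsto (fun k : ℕ => 1 / ((k : ℝ) + 1)) atTop (𝓝 0) :=
    tendsto_one_div_add_atTop_nhds_zero_nat
  have hε1 : ∀ k : ℕ, 1 / ((k : ℝ) + 1) ≤ 1 := fun k => by
    rw [div_le_one (by positivity)]
    linarith [k.cast_nonneg (α := ℝ)]
  have hbdd : ∀ k, l k ∈ Metric.closedBall (0 : EuclideanSpace ℝ (Fin m))
      (κ * (‖fderiv ℝ f xb‖ + 1) + 1) := fun k => by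
    rw [mem_closedBall_zero_iff]
    refine (hln k).trans ?_
    gcongr <;> exact hε1 k
  obtain ⟨l₀, -, φ, hφ, hlim⟩ := (isCompact_closedBall _ _).tendsto_subseq hbdd
  have hεφ := hε.comp hφ.tendsto_atTop
  have hxlim : Tendsto (x ∘ φ) atTop (𝓝 xb) :=
    tendsto_iff_norm_sub_tendsto_zero.2
      (squeeze_zero (fun _ => norm_nonneg _) (fun k => hx (φ k)) hεφ)
  refine ⟨l₀, ⟨t ∘ φ, v ∘ φ, l ∘ φ, fun k => ht _, ?_, ?_, hlim, fun k => hl _⟩, ?_, fun u => ?_⟩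
  · exact squeeze_zero (fun k => (ht _).le) (fun k => htk (φ k)) hεφ
  · exact tendsto_iff_norm_sub_tendsto_zero.2
      (squeeze_zero (fun _ => norm_nonneg _) (fun k => hv (φ k)) hεφ)
  · refine le_of_tendsto_of_tendsto' hlim.norm ?_ (fun k => hln (φ k))
    simpa using ((hεφ.const_add ‖fderiv ℝ f xb‖).const_mul κ).add hεφ
  · have hfu : Tendsto (fun k => fderiv ℝ f (x (φ k)) u) atTop (𝓝 (fderiv ℝ f xb u)) :=
      (((hf.continuous_fderiv one_ne_zero).clm_apply continuous_const).tendsto xb).comp hxlim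
    have hgu : Tendsto (fun k => fderiv ℝ g (x (φ k)) u) atTop (𝓝 (fderiv ℝ g xb u)) :=
      (((hg.continuous_fderiv one_ne_zero).clm_apply continuous_const).tendsto xb).comp hxlim
    have h1 := (hfu.add (hlim.inner hgu)).abs
    have h2 := hεφ.mul (hgu.norm.const_add ‖u‖)
    rw [zero_mul] at h2
    exact abs_nonpos_iff.1 (le_of_tendsto_of_tendsto' h1 h2 fun k => hu (φ k) u)
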